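/- Let d ≥ 3 be an integer and let Ω ⊆ ℝ^d be a nonempty open bounded convex set whose boundary is of class C⁴, in the sense that for every p ∈ ∂Ω there exist an open neighborhood U of p and a four-times continuously differentiable function Φ : U → ℝ with ∇Φ(z) ≠ 0 for all z ∈ U, Ω ∩ U = {z ∈ U : Φ(z) < 0} and ∂Ω ∩ U = {z ∈ U : Φ(z) = 0}. Let n : ∂Ω → ℝ^d satisfy ‖n(x)‖ = 1 and ⟪w − x, n(x)⟫ ≤ 0 for all x ∈ ∂Ω and w ∈ Ω (an outward unit normal field). Set G(x,y) = ‖x − y‖^{2−d}/((2−d)·ω_d) for x ≠ y. Suppose q : cl(Ω) × Ω → ℝ satisfies: (a) q(x,y) = q(y,x) for all x, y ∈ Ω; (b) for every y ∈ Ω, x ↦ q(x,y) is twice continuously differentiable on Ω with Δ_x q(x,y) = −1/vol(Ω) for all x ∈ Ω, where vol(Ω) is the Lebesgue measure of Ω, and both q(·,y) and its gradient ∇_x q(·,y) extend continuously to cl(Ω); (c) for every y ∈ Ω and every x ∈ ∂Ω, ⟪∇_x G(x,y) + ∇_x q(x,y), n(x)⟫ = 0. Then there exist constants c₁, c₂ >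 0 such that q(x,x) ≤ c₁ − c₂ · dist(x, ∂Ω)^{2−d} for every x ∈ Ω. -/

import Mathlib

open scoped BigOperators RealInnerProductSpace

/-- The surface area `ω_d = 2π^{d/2}/Γ(d/2)` of the unit sphere in `ℝ^d`. -/
noncomputable def sphereArea (d : ℕ) : ℝ :=
  2 * Real.pi ^ ((d : ℝ) / 2) / Real.Gamma ((d : ℝ) / 2)

/-- The fundamental solution `G(x,y) = ‖x − y‖^{2−d}/((2−d)·ω_d)` of the Laplacian in `ℝ^d`,
`d ≥ 3`. -/
noncomputable def fundSol (d : ℕ) (x y : EuclideanSpace ℝ (Fin d)) : ℝ :=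
  ‖x - y‖ ^ ((2 : ℝ) - d) / (((2 : ℝ) - d) * sphereArea d)

/-- `Ω` has boundary of class `C⁴`: near each boundary point there is a four-times
continuously differentiable local defining function with nonvanishing derivative. -/
def IsC4Boundary {d : ℕ} (Ω : Set (EuclideanSpace ℝ (Fin d))) : Prop :=
  ∀ p ∈ frontier Ω, ∃ (U : Set (EuclideanSpace ℝ (Fin d))) (Φ : EuclideanSpace ℝ (Fin d) → ℝ),
    IsOpen U ∧ p ∈ U ∧ ContDiffOn ℝ 4 Φ U ∧ (∀ z ∈ U, fderivWithin ℝ Φ U z ≠ 0) ∧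
    Ω ∩ U = {z ∈ U | Φ z < 0} ∧ frontier Ω ∩ U = {z ∈ U | Φ z = 0}

open Filter Topology

/-- A function with gradient field `g` near `x` whose Hessian `H` at `x` has positive trace has no
local maximum at `x`. -/
lemma not_isLocalMax_of_trace_pos {d : ℕ} {f : EuclideanSpace ℝ (Fin d) → ℝ}
    {g : EuclideanSpace ℝ (Fin d) → EuclideanSpace ℝ (Fin d)} {x : EuclideanSpace ℝ (Fin d)}
    {H : EuclideanSpace ℝ (Fin d) →L[ℝ] EuclideanSpace ℝ (Fin d)}
    (hg : ∀ᶠ z in 𝓝 x, HasGradientAt f (g z) z) (hH : HasFDerivAt g H x)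
    (hpos : 0 < ∑ i, ⟪H (EuclideanSpace.single i 1), EuclideanSpace.single i 1⟫) :
    ¬ IsLocalMax f x := by
  intro hmax
  obtain ⟨i, -, hi⟩ := Finset.exists_lt_of_sum_lt
    (f := fun _ : Fin d => (0 : ℝ)) (by simpa using hpos)
  set e : EuclideanSpace ℝ (Fin d) := EuclideanSpace.single i 1
  have hline : ∀ t : ℝ, HasDerivAt (fun t : ℝ => x + t • e) e t := fun t => by
    simpa using ((hasDerivAt_id t).smul_const e).const_add x
  have htend : Tendsto (fun t : ℝ => x + t • e) (𝓝 0) (𝓝 x) := by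
    simpa using (hline 0).continuousAt.tendsto
  have hφ : ∀ᶠ t : ℝ in 𝓝 0, HasDerivAt (fun t : ℝ => f (x + t • e)) ⟪g (x + t • e), e⟫ t := by
    filter_upwards [htend.eventually hg] with t ht
    simpa [Function.comp_def] using ht.hasFDerivAt.comp_hasDerivAt t (hline t)
  have hφ' : deriv (fun t : ℝ => f (x + t • e)) =ᶠ[𝓝 0] fun t => ⟪g (x + t • e), e⟫ :=
    hφ.mono fun t ht => ht.deriv
  have hφ'' : HasDerivAt (fun t : ℝ => ⟪g (x + t • e), e⟫) ⟪H e, e⟫ 0 := by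
    have hH' : HasFDerivAt g H (x + (0 : ℝ) • e) := by simpa using hH
    simpa using (hH'.comp_hasDerivAt (0 : ℝ) (hline 0)).inner ℝ (hasDerivAt_const (0 : ℝ) e)
  have hlmax : IsLocalMax (fun t : ℝ => f (x + t • e)) 0 := by
    filter_upwards [htend.eventually hmax] with t ht
    simpa using ht
  have hdd : deriv (deriv fun t : ℝ => f (x + t • e)) 0 = ⟪H e, e⟫ := by
    rw [hφ'.deriv_eq, hφ''.deriv]
  have hlmin : IsLocalMin (fun t : ℝ => f (x + t • e)) 0 :=
    isLocalMin_of_deriv_deriv_pos (by rw [hdd]; exact hi) hlmax.deriv_eq_zero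
      hφ.self_of_nhds.continuousAt
  have hconst : (fun t : ℝ => f (x + t • e)) =ᶠ[𝓝 0] fun _ => f (x + (0 : ℝ) • e) := by
    filter_upwards [hlmax, hlmin] with t h₁ h₂ using le_antisymm h₁ h₂
  have : deriv (deriv fun t : ℝ => f (x + t • e)) 0 = 0 := by
    rw [hconst.deriv.deriv_eq]; simp
  linarith [hdd, this]

/-- If `f` is differentiable in `Ω` near `p`, `f` and its gradient extend continuously to `p`, and
the derivative at `p` in the direction `-ν` pointing into `Ω` is positive, then `f` takes values
above `f p` along this direction. -/
lemma eventually_lt_of_inner_neg {E : Type*} [NormedAddCommGroup E] [InnerProductSpace ℝ E]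
    [CompleteSpace E] {Ω : Set E} {f : E → ℝ} {g : E → E} {p ν : E}
    (hin : ∀ᶠ t : ℝ in 𝓝[>] 0, p - t • ν ∈ Ω)
    (hfg : ∀ᶠ z in 𝓝 p, z ∈ Ω → HasGradientAt f (g z) z)
    (hf : ContinuousWithinAt f (closure Ω) p) (hg : ContinuousWithinAt g (closure Ω) p)
    (hneg : ⟪g p, ν⟫ < 0) : ∀ᶠ t : ℝ in 𝓝[>] 0, f p < f (p - t • ν) := by
  have hline : ∀ t : ℝ, HasDerivAt (fun t : ℝ => p - t • ν) (-ν) t := fun t => by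
    simpa using ((hasDerivAt_id t).smul_const ν).const_sub p
  have htend : Tendsto (fun t : ℝ => p - t • ν) (𝓝 0) (𝓝 p) := by
    simpa using (hline 0).continuousAt.tendsto
  have hφ : ∀ᶠ t : ℝ in 𝓝[>] 0,
      HasDerivAt (fun t : ℝ => f (p - t • ν)) (-⟪g (p - t • ν), ν⟫) t := by
    filter_upwards [(htend.mono_left nhdsWithin_le_nhds).eventually hfg, hin] with t ht htΩ
    simpa [Function.comp_def] using (ht htΩ).hasFDerivAt.comp_hasDerivAt t (hline t)
  have htendΩ : Tendsto (fun t : ℝ => p - t • ν) (𝓝[>] 0) (𝓝[closure Ω] p) :=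
    tendsto_nhdsWithin_iff.2 ⟨htend.mono_left nhdsWithin_le_nhds,
      hin.mono fun t ht => subset_closure ht⟩
  have hlim : Tendsto (fun t => deriv (fun t : ℝ => f (p - t • ν)) t) (𝓝[>] 0)
      (𝓝 (-⟪g p, ν⟫)) := by
    refine Tendsto.congr' (hφ.mono fun t ht => ht.deriv.symm) ?_
    exact ((hg.tendsto.comp htendΩ).inner tendsto_const_nhds).neg
  set s : Set ℝ := {t | 0 < t ∧ HasDerivAt (fun t : ℝ => f (p - t • ν)) (-⟪g (p - t • ν), ν⟫) t}
  have hs : s ∈ 𝓝[>] (0 : ℝ) := by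
    filter_upwards [hφ, self_mem_nhdsWithin] with t h₁ h₂ using ⟨h₂, h₁⟩
  have hcont : ContinuousWithinAt (fun t : ℝ => f (p - t • ν)) s 0 := by
    have : Tendsto (fun t : ℝ => f (p - t • ν)) (𝓝[>] 0) (𝓝 (f (p - (0 : ℝ) • ν))) := by
      simpa [Function.comp_def] using hf.tendsto.comp htendΩ
    exact this.mono_left (nhdsWithin_mono _ fun t ht => ht.1)
  have hder := hasDerivWithinAt_Ici_of_tendsto_deriv
    (fun t ht => ht.2.differentiableAt.differentiableWithinAt) hcont hs hlim
  have hslope := (hasDerivWithinAt_iff_tendsto_slope.1 hder).eventually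
    (lt_mem_nhds (show (0 : ℝ) < -⟪g p, ν⟫ by linarith))
  rw [show Set.Ici (0 : ℝ) \ {0} = Set.Ioi 0 by ext t; simp [lt_iff_le_and_ne, eq_comm]] at hslope
  filter_upwards [hslope, self_mem_nhdsWithin] with t ht htpos
  have htpos : (0 : ℝ) < t := htpos
  rw [slope_def_field, sub_zero] at ht
  have := (div_pos_iff_of_pos_right htpos).1 ht
  simpa using this

lemma sphereArea_pos {d : ℕ} (hd : 3 ≤ d) : 0 < sphereArea d := by
  have : (0 : ℝ) < d := by exact_mod_cast (by omega : 0 < d)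
  have := Real.Gamma_pos_of_pos (half_pos this)
  have := Real.pi_pos
  unfold sphereArea
  positivity

/-- The gradient `x ↦ (x - a) / (ω_d ‖x - a‖^d)` of the fundamental solution with pole `a`. -/
noncomputable def fundSolGrad (d : ℕ) (x a : EuclideanSpace ℝ (Fin d)) :
    EuclideanSpace ℝ (Fin d) :=
  ((sphereArea d)⁻¹ * (‖x - a‖ ^ 2) ^ (-(d : ℝ) / 2)) • (x - a)

lemma hasFDerivAt_norm_sub_sq {E : Type*} [NormedAddCommGroup E] [InnerProductSpace ℝ E]
    (x a : E) : HasFDerivAt (fun x => ‖x - a‖ ^ 2) (2 • innerSL ℝ (x - a)) x := by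
  simpa using ((hasFDerivAt_id x).sub_const a).norm_sq

lemma hasGradientAt_fundSol {d : ℕ} (hd : 3 ≤ d) {x a : EuclideanSpace ℝ (Fin d)} (h : x ≠ a) :
    HasGradientAt (fun x => fundSol d x a) (fundSolGrad d x a) x := by
  have hω := sphereArea_pos hd
  have hd' : (2 : ℝ) - d ≠ 0 := by
    have : (3 : ℝ) ≤ d := by exact_mod_cast hd
    linarith
  have hx : 0 < ‖x - a‖ := norm_pos_iff.2 (sub_ne_zero.2 h)
  have key := ((hasFDerivAt_norm_sub_sq x a).rpow_const (p := ((2 : ℝ) - d) / 2)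
    (Or.inl (by positivity))).mul_const ((((2 : ℝ) - d) * sphereArea d)⁻¹)
  rw [hasGradientAt_iff_hasFDerivAt]
  refine (key.congr_of_eventuallyEq (Eventually.of_forall fun z => ?_)).congr_fderiv ?_
  · simp only [fundSol]
    rw [← Real.rpow_natCast, ← Real.rpow_mul (norm_nonneg _), div_eq_mul_inv]
    congr 2
    push_cast; ring
  · ext v
    simp only [fundSolGrad, InnerProductSpace.toDual_apply_apply, inner_smul_left]
    simp
    rw [show ((2 : ℝ) - d) / 2 - 1 = -d / 2 by ring]
    field_simp
    rw [inner_sub_left]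

lemma exists_hasFDerivAt_fundSolGrad {d : ℕ} {x a : EuclideanSpace ℝ (Fin d)} (h : x ≠ a) :
    ∃ H : EuclideanSpace ℝ (Fin d) →L[ℝ] EuclideanSpace ℝ (Fin d),
      HasFDerivAt (fun x => fundSolGrad d x a) H x ∧
      ∑ i, ⟪H (EuclideanSpace.single i 1), EuclideanSpace.single i 1⟫ = 0 := by
  have hx : 0 < ‖x - a‖ := norm_pos_iff.2 (sub_ne_zero.2 h)
  have key := (((hasFDerivAt_norm_sub_sq x a).rpow_const (p := -(d : ℝ) / 2)
    (Or.inl (by positivity))).const_mul (sphereArea d)⁻¹).smul ((hasFDerivAt_id x).sub_const a)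
  refine ⟨_, key, ?_⟩
  have hs : ∑ i, (x i - a i) * (x i - a i) = ‖x - a‖ ^ 2 := by
    rw [EuclideanSpace.norm_sq_eq]
    exact Finset.sum_congr rfl fun i _ => by simp [sq]
  have hr : (‖x - a‖ ^ 2) ^ (-(d : ℝ) / 2) = (‖x - a‖ ^ 2) ^ (-(d : ℝ) / 2 - 1) * ‖x - a‖ ^ 2 := by
    rw [Real.rpow_sub_one (by positivity)]
    field_simp
  simp [inner_add_left, inner_smul_left, Finset.sum_add_distrib, EuclideanSpace.inner_single_right]
  have hsum : ∑ i, (sphereArea d)⁻¹ * (-(d : ℝ) / 2 * (‖x - a‖ ^ 2) ^ (-(d : ℝ) / 2 - 1) *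
      (2 * (x i - a i))) * (x i - a i) =
      -(d * ((sphereArea d)⁻¹ * (‖x - a‖ ^ 2) ^ (-(d : ℝ) / 2 - 1))) *
        ∑ i, (x i - a i) * (x i - a i) := by
    rw [Finset.mul_sum]
    exact Finset.sum_congr rfl fun i _ => by ring
  rw [hsum, hs, hr]
  ring

lemma fundSol_nonpos {d : ℕ} (hd : 3 ≤ d) (x a : EuclideanSpace ℝ (Fin d)) :
    fundSol d x a ≤ 0 := by
  have hω := sphereArea_pos hd
  have hd' : (3 : ℝ) ≤ d := by exact_mod_cast hd
  exact div_nonpos_of_nonneg_of_nonpos (by positivity)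
    (mul_nonpos_of_nonpos_of_nonneg (by linarith) hω.le)

lemma le_fundSol {d : ℕ} (hd : 3 ≤ d) {x a : EuclideanSpace ℝ (Fin d)} {ρ : ℝ} (hρ : 0 < ρ)
    (h : ρ ≤ ‖x - a‖) : ρ ^ ((2 : ℝ) - d) / (((2 : ℝ) - d) * sphereArea d) ≤ fundSol d x a := by
  have hω := sphereArea_pos hd
  have hd' : (3 : ℝ) ≤ d := by exact_mod_cast hd
  exact div_le_div_of_nonpos_of_le
    (mul_nonpos_of_nonpos_of_nonneg (by linarith) hω.le)
    (Real.rpow_le_rpow_of_nonpos hρ h (by linarith))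

lemma inner_fundSolGrad (d : ℕ) (x a ν : EuclideanSpace ℝ (Fin d)) :
    ⟪fundSolGrad d x a, ν⟫ =
      (sphereArea d)⁻¹ * (‖x - a‖ ^ 2) ^ (-(d : ℝ) / 2) * ⟪x - a, ν⟫ := by
  rw [fundSolGrad, real_inner_smul_left]

lemma inner_sub_nonpos_of_mem_closure {E : Type*} [NormedAddCommGroup E] [InnerProductSpace ℝ E]
    {Ω : Set E} {x ν : E} (h : ∀ w ∈ Ω, ⟪w - x, ν⟫ ≤ 0) {w : E} (hw : w ∈ closure Ω) :
    ⟪w - x, ν⟫ ≤ 0 := by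
  have hcl : IsClosed {w : E | ⟪w - x, ν⟫ ≤ 0} := isClosed_le (by fun_prop) continuous_const
  exact closure_minimal h hcl hw

/-- A supporting hyperplane of a set containing `ball y r` lies at distance at least `r`
from `y`. -/
lemma le_inner_sub_of_ball_subset {E : Type*} [NormedAddCommGroup E] [InnerProductSpace ℝ E]
    {Ω : Set E} {x ν y : E} {r : ℝ} (h : ∀ w ∈ Ω, ⟪w - x, ν⟫ ≤ 0) (hν : ‖ν‖ = 1) (hr : 0 < r)
    (hball : Metric.ball y r ⊆ Ω) : r ≤ ⟪x - y, ν⟫ := by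
  have hmem : y + r • ν ∈ closure Ω := by
    refine closure_mono hball ?_
    rw [closure_ball _ hr.ne']
    simp [norm_smul, hν, abs_of_pos hr]
  have := inner_sub_nonpos_of_mem_closure h hmem
  rw [show y + r • ν - x = r • ν - (x - y) by abel, inner_sub_left, real_inner_smul_left,
    real_inner_self_eq_norm_sq, hν] at this
  linarith

lemma IsC4Boundary.eventually_sub_smul_mem {d : ℕ} {Ω : Set (EuclideanSpace ℝ (Fin d))}
    (hC4 : IsC4Boundary Ω) {p ν : EuclideanSpace ℝ (Fin d)} (hp : p ∈ frontier Ω)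
    (hν : ‖ν‖ = 1) (h : ∀ w ∈ Ω, ⟪w - p, ν⟫ ≤ 0) : ∀ᶠ t : ℝ in 𝓝[>] 0, p - t • ν ∈ Ω := by
  obtain ⟨U, Φ, hU, hpU, hΦ, hΦ', hΩ, hfr⟩ := hC4 p hp
  have hΦp : Φ p = 0 := by
    have : p ∈ {z ∈ U | Φ z = 0} := hfr ▸ ⟨hp, hpU⟩
    exact this.2
  have hdiff : DifferentiableAt ℝ Φ p :=
    (hΦ.contDiffAt (hU.mem_nhds hpU)).differentiableAt (by norm_num)
  have hne := hΦ' p hpU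
  rw [fderivWithin_of_isOpen hU hpU] at hne
  set g := gradient Φ p
  have hgrad : HasGradientAt Φ g p := hdiff.hasGradientAt
  have hg0 : g ≠ 0 := fun h0 => hne (by
    rw [hgrad.hasFDerivAt.fderiv, h0, map_zero])
  have hinto : ∀ v, ⟪g, v⟫ < 0 → ∀ᶠ t : ℝ in 𝓝[>] 0, p + t • v ∈ Ω := by
    intro v hv
    have hline : HasDerivAt (fun t : ℝ => p + t • v) v 0 := by
      simpa using ((hasDerivAt_id (0 : ℝ)).smul_const v).const_add p
    have hgrad' : HasFDerivAt Φ (InnerProductSpace.toDual ℝ _ g) (p + (0 : ℝ) • v) := by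
      simpa using hgrad.hasFDerivAt
    have hder : HasDerivAt (fun t : ℝ => Φ (p + t • v)) ⟪g, v⟫ 0 := by
      simpa [Function.comp_def] using hgrad'.comp_hasDerivAt (0 : ℝ) hline
    have hmemU : ∀ᶠ t : ℝ in 𝓝[>] 0, p + t • v ∈ U := by
      have : Tendsto (fun t : ℝ => p + t • v) (𝓝 0) (𝓝 p) := by
        simpa using hline.continuousAt.tendsto
      exact (this.mono_left nhdsWithin_le_nhds).eventually (hU.mem_nhds hpU)
    have hslope := ((hasDerivAt_iff_tendsto_slope.1 hder).mono_left
      (nhdsWithin_mono _ fun t (ht : 0 < t) => ht.ne')).eventually (gt_mem_nhds hv)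
    filter_upwards [hslope, hmemU, self_mem_nhdsWithin] with t ht htU htpos
    have htpos : (0 : ℝ) < t := htpos
    rw [slope_def_field, sub_zero, div_lt_iff₀ htpos] at ht
    have : p + t • v ∈ {z ∈ U | Φ z < 0} := ⟨htU, by simpa [hΦp] using ht⟩
    rw [← hΩ] at this
    exact this.1
  have hhalf : ∀ v, ⟪g, v⟫ < 0 → ⟪v, ν⟫ ≤ 0 := by
    intro v hv
    obtain ⟨t, ht, htpos⟩ := ((hinto v hv).and self_mem_nhdsWithin).exists
    have := h _ ht
    rw [add_sub_cancel_left, real_inner_smul_left] at this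
    exact nonpos_of_mul_nonpos_right this htpos
  have hgν : 0 < ⟪g, ν⟫ := by
    rcases lt_trichotomy ⟪g, ν⟫ 0 with hlt | heq | hgt
    · have := hhalf ν hlt
      rw [real_inner_self_eq_norm_sq, hν] at this
      norm_num at this
    · have hgg : 0 < ⟪g, g⟫ := real_inner_self_pos.2 hg0
      have := hhalf (ν - g) (by rw [inner_sub_right, heq]; linarith)
      rw [inner_sub_left, heq, real_inner_self_eq_norm_sq, hν] at this
      norm_num at this
    · exact hgt
  simpa [sub_eq_add_neg] using hinto (-ν) (by rw [inner_neg_right]; linarith)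

/-- Maximum principle on a bounded domain with the ball `ball y₀ r` removed: a strictly subharmonic
function with negative outward derivative along the outer boundary is bounded by its values on the
sphere of radius `r`. -/
lemma le_of_le_on_sphere {d : ℕ} {Ω : Set (EuclideanSpace ℝ (Fin d))}
    (hopen : IsOpen Ω) (hbd : Bornology.IsBounded Ω)
    {y₀ : EuclideanSpace ℝ (Fin d)} {r C : ℝ} (hr : 0 < r) (hball : Metric.closedBall y₀ r ⊆ Ω)
    {n : EuclideanSpace ℝ (Fin d) → EuclideanSpace ℝ (Fin d)}
    (hin : ∀ p ∈ frontier Ω, ∀ᶠ t : ℝ in 𝓝[>] 0, p - t • n p ∈ Ω)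
    {f : EuclideanSpace ℝ (Fin d) → ℝ} {g : EuclideanSpace ℝ (Fin d) → EuclideanSpace ℝ (Fin d)}
    (hfg : ∀ z ∈ Ω, z ≠ y₀ → HasGradientAt f (g z) z)
    (hf : ContinuousOn f (closure Ω \ {y₀})) (hg : ContinuousOn g (closure Ω \ {y₀}))
    (htr : ∀ z ∈ Ω, z ≠ y₀ → ∃ H : EuclideanSpace ℝ (Fin d) →L[ℝ] EuclideanSpace ℝ (Fin d),
      HasFDerivAt g H z ∧
      0 < ∑ i, ⟪H (EuclideanSpace.single i 1), EuclideanSpace.single i 1⟫)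
    (hneg : ∀ p ∈ frontier Ω, ⟪g p, n p⟫ < 0)
    (hsphere : ∀ z, dist z y₀ = r → f z ≤ C) {x : EuclideanSpace ℝ (Fin d)} (hx : x ∈ Ω)
    (hxr : r ≤ dist x y₀) : f x ≤ C := by
  set K := closure Ω \ Metric.ball y₀ r
  have hKc : IsCompact K := hbd.isCompact_closure.diff Metric.isOpen_ball
  have hKsub : K ⊆ closure Ω \ {y₀} := fun z hz =>
    ⟨hz.1, fun h => hz.2 (by rw [Set.mem_singleton_iff.1 h]; exact Metric.mem_ball_self hr)⟩
  have hxK : x ∈ K := ⟨subset_closure hx, by simpa using hxr⟩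
  obtain ⟨z, hzK, hz⟩ := hKc.exists_isMaxOn ⟨x, hxK⟩ (hf.mono hKsub)
  refine (hz hxK).trans ?_
  have hzr : r ≤ dist z y₀ := by simpa using hzK.2
  rcases hzr.eq_or_lt with heq | hlt
  · exact hsphere z heq.symm
  exfalso
  have hz0 : z ≠ y₀ := by
    rintro rfl
    simp at hlt
    linarith
  have hfar : ∀ᶠ w in 𝓝 z, r < dist w y₀ :=
    (continuous_id.dist continuous_const).continuousAt.eventually (lt_mem_nhds hlt)
  have hne : ∀ᶠ w in 𝓝 z, w ≠ y₀ := isOpen_ne.mem_nhds hz0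
  by_cases hzΩ : z ∈ Ω
  · obtain ⟨H, hH, hpos⟩ := htr z hzΩ hz0
    refine not_isLocalMax_of_trace_pos (f := f) ?_ hH hpos ?_
    · filter_upwards [hne, hopen.mem_nhds hzΩ] with w h₁ h₂ using hfg w h₂ h₁
    · filter_upwards [hfar, hopen.mem_nhds hzΩ] with w h₁ h₂
      exact hz ⟨subset_closure h₂, by simpa using h₁.le⟩
  · have hzfr : z ∈ frontier Ω := by
      rw [hopen.frontier_eq]; exact ⟨hzK.1, hzΩ⟩
    have hmem : closure Ω \ {y₀} ∈ 𝓝[closure Ω] z :=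
      inter_mem self_mem_nhdsWithin (mem_nhdsWithin_of_mem_nhds hne)
    have hup := eventually_lt_of_inner_neg (hin z hzfr)
      (hne.mono fun w hw hwΩ => hfg w hwΩ hw)
      ((hf z (hKsub hzK)).mono_of_mem_nhdsWithin hmem)
      ((hg z (hKsub hzK)).mono_of_mem_nhdsWithin hmem) (hneg z hzfr)
    have htend : Tendsto (fun t : ℝ => z - t • n z) (𝓝[>] 0) (𝓝 z) := by
      have : ContinuousAt (fun t : ℝ => z - t • n z) 0 := by fun_prop
      simpa using this.tendsto.mono_left nhdsWithin_le_nhds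
    obtain ⟨t, ⟨ht₁, ht₂⟩, ht₃⟩ := ((hup.and (hin z hzfr)).and (htend.eventually hfar)).exists
    exact absurd (hz ⟨subset_closure ht₂, by simpa using ht₃.le⟩) (not_le.2 ht₁)

lemma ball_infDist_frontier_subset {E : Type*} [NormedAddCommGroup E] [NormedSpace ℝ E]
    {Ω : Set E} (hopen : IsOpen Ω) {y : E} (hy : y ∈ Ω) :
    Metric.ball y (Metric.infDist y (frontier Ω)) ⊆ Ω := by
  rcases (Metric.ball y (Metric.infDist y (frontier Ω))).eq_empty_or_nonempty with h | h
  · simp [h]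
  have hdisj : Disjoint (Metric.ball y (Metric.infDist y (frontier Ω))) (frontier Ω) :=
    Metric.disjoint_ball_infDist
  refine (convex_ball y _).isPreconnected.subset_left_of_subset_union hopen
    isClosed_closure.isOpen_compl
    (Set.disjoint_left.2 fun z hz hz' => hz' (subset_closure hz)) ?_
    ⟨y, Metric.mem_ball_self (Metric.nonempty_ball.1 h), hy⟩
  intro z hz
  by_cases hzc : z ∈ closure Ω
  · by_contra hcon
    refine Set.disjoint_left.1 hdisj hz ?_
    rw [hopen.frontier_eq]
    exact ⟨hzc, fun h => hcon (Or.inl h)⟩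
  · exact Or.inr hzc

/-- A pointwise bounded family of continuous functions on a nonempty open set is uniformly bounded
above on some ball. -/
lemma exists_ball_uniform_bound {d : ℕ} {Ω : Set (EuclideanSpace ℝ (Fin d))} (hopen : IsOpen Ω)
    (hne : Ω.Nonempty) {ι : Type*} {u : ι → EuclideanSpace ℝ (Fin d) → ℝ}
    (hu : ∀ i, ContinuousOn (u i) Ω) (hbound : ∀ x ∈ Ω, ∃ C, ∀ i, u i x ≤ C) :
    ∃ y₀, ∃ r > 0, ∃ N : ℝ, Metric.ball y₀ r ⊆ Ω ∧ ∀ x ∈ Metric.ball y₀ r, ∀ i, u i x ≤ N := by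
  have := hopen.baireSpace
  have := hne.to_subtype
  obtain ⟨N, y, hy⟩ := nonempty_interior_of_iUnion_of_closed
    (f := fun N : ℕ => {x : Ω | ∀ i, u i x ≤ N})
    (fun N => by
      simp only [Set.ofPred_forall]
      exact isClosed_iInter fun i =>
        isClosed_le (continuousOn_iff_continuous_domRestrict.1 (hu i)) continuous_const)
    (by
      refine Set.eq_univ_of_forall fun x => ?_
      obtain ⟨C, hC⟩ := hbound x x.2
      obtain ⟨N, hN⟩ := exists_nat_ge C
      exact Set.mem_iUnion.2 ⟨N, fun i => (hC i).trans hN⟩)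
  have hopen' := hopen.isOpenMap_subtype_val _ (isOpen_interior (s := {x : Ω | ∀ i, u i x ≤ N}))
  obtain ⟨r, hr, hsub⟩ := Metric.isOpen_iff.1 hopen' y ⟨y, hy, rfl⟩
  refine ⟨y, r, hr, N, fun x hx => ?_, fun x hx => ?_⟩
  · obtain ⟨z, -, rfl⟩ := hsub hx
    exact z.2
  · obtain ⟨z, hz, rfl⟩ := hsub hx
    exact interior_subset hz

/-- The mirror image of a point `y` of a convex domain in the supporting hyperplane at the
boundary point closest to `y`. -/
lemma exists_reflection {E : Type*} [NormedAddCommGroup E] [InnerProductSpace ℝ E] [ProperSpace E]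
    {Ω : Set E} (hopen : IsOpen Ω) (hfr : (frontier Ω).Nonempty) {n : E → E}
    (hn1 : ∀ x ∈ frontier Ω, ‖n x‖ = 1) (hn2 : ∀ x ∈ frontier Ω, ∀ w ∈ Ω, ⟪w - x, n x⟫ ≤ 0)
    {y : E} (hy : y ∈ Ω) :
    0 < Metric.infDist y (frontier Ω) ∧
    ∃ y' ∉ closure Ω, ‖y - y'‖ = 2 * Metric.infDist y (frontier Ω) ∧
      ∀ p ∈ frontier Ω, ‖p - y‖ ≤ ‖p - y'‖ ∧ ⟪y' - p, n p⟫ ≤ Metric.infDist y (frontier Ω) := by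
  have hball := ball_infDist_frontier_subset hopen hy
  obtain ⟨p, hp, hpy⟩ := isClosed_frontier.exists_infDist_eq_dist hfr y
  set δ := Metric.infDist y (frontier Ω)
  have hpΩ : p ∉ Ω := by
    rw [hopen.frontier_eq] at hp
    exact hp.2
  have hδ : 0 < δ := by
    rw [hpy]
    exact dist_pos.2 fun h => hpΩ (h ▸ hy)
  have hδp : ‖p - y‖ = δ := by rw [hpy, dist_comm, dist_eq_norm]
  have hle := le_inner_sub_of_ball_subset (hn2 p hp) (hn1 p hp) hδ hball
  have hpν : p - y = δ • n p := by
    have : ‖(p - y) - δ • n p‖ ^ 2 ≤ 0 := by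
      rw [norm_sub_sq_real, real_inner_smul_right, norm_smul, hδp, hn1 p hp, Real.norm_eq_abs,
        abs_of_pos hδ]
      nlinarith
    exact sub_eq_zero.1 (norm_eq_zero.1 (pow_eq_zero_iff two_ne_zero |>.1
      (le_antisymm this (sq_nonneg _))))
  have hyp : y = p - δ • n p := by rw [← hpν]; abel
  refine ⟨hδ, p + δ • n p, fun hmem => ?_, ?_, fun x hx => ⟨?_, ?_⟩⟩
  · have := inner_sub_nonpos_of_mem_closure (hn2 p hp) hmem
    rw [add_sub_cancel_left, real_inner_smul_left, real_inner_self_eq_norm_sq, hn1 p hp] at this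
    linarith
  · rw [hyp, show p - δ • n p - (p + δ • n p) = -((2 * δ) • n p) by module, norm_neg, norm_smul,
      hn1 p hp, Real.norm_eq_abs, abs_of_pos (by positivity), mul_one]
  · have h := inner_sub_nonpos_of_mem_closure (hn2 p hp) (frontier_subset_closure hx)
    refine le_of_sq_le_sq ?_ (norm_nonneg _)
    rw [hyp, show x - (p - δ • n p) = (x - p) + δ • n p by abel,
      show x - (p + δ • n p) = (x - p) - δ • n p by abel, norm_add_sq_real (x - p),
      norm_sub_sq_real (x - p), real_inner_smul_right]
    nlinarith
  · have h := inner_sub_nonpos_of_mem_closure (hn2 x hx) (frontier_subset_closure hp)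
    have h' := real_inner_le_norm (n p) (n x)
    rw [hn1 p hp, hn1 x hx] at h'
    rw [show p + δ • n p - x = (p - x) + δ • n p by abel, inner_add_left, real_inner_smul_left]
    nlinarith

/-- The gradient field of a `C²` function on an open set is differentiable, and its derivative has
the Laplacian as its trace. -/
lemma exists_hasFDerivAt_gradient {d : ℕ} {Ω : Set (EuclideanSpace ℝ (Fin d))} (hopen : IsOpen Ω)
    {f : EuclideanSpace ℝ (Fin d) → ℝ} {g : EuclideanSpace ℝ (Fin d) → EuclideanSpace ℝ (Fin d)}
    (hf : ContDiffOn ℝ 2 f Ω) (hfg : ∀ x ∈ Ω, HasGradientAt f (g x) x)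
    {x : EuclideanSpace ℝ (Fin d)} (hx : x ∈ Ω) :
    ∃ H : EuclideanSpace ℝ (Fin d) →L[ℝ] EuclideanSpace ℝ (Fin d), HasFDerivAt g H x ∧
      ∑ i, ⟪H (EuclideanSpace.single i 1), EuclideanSpace.single i 1⟫ =
        ∑ i : Fin d, iteratedFDerivWithin ℝ 2 f Ω x
          ![EuclideanSpace.single i 1, EuclideanSpace.single i 1] := by
  have hd : DifferentiableAt ℝ (fderiv ℝ f) x :=
    ((hf.contDiffAt (hopen.mem_nhds hx)).fderiv_right (m := 1) (by norm_num)).differentiableAt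
      (by norm_num)
  let L : StrongDual ℝ (EuclideanSpace ℝ (Fin d)) →L[ℝ] EuclideanSpace ℝ (Fin d) :=
    LinearMap.toContinuousLinearMap
      { toFun := (InnerProductSpace.toDual ℝ (EuclideanSpace ℝ (Fin d))).symm
        map_add' := by simp
        map_smul' := by simp }
  have hcomp : HasFDerivAt (fun z => L (fderiv ℝ f z))
      (L.comp (fderiv ℝ (fderiv ℝ f) x)) x :=
    L.hasFDerivAt.comp x hd.hasFDerivAt
  refine ⟨_, hcomp.congr_of_eventuallyEq ?_, Finset.sum_congr rfl fun i _ => ?_⟩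
  · filter_upwards [hopen.mem_nhds hx] with z hz
    rw [(hfg z hz).hasFDerivAt.fderiv]
    simp [L]
  · rw [iteratedFDerivWithin_of_isOpen 2 hopen hx, iteratedFDeriv_two_apply]
    simp [L]

/-- **Upper bound for the Neumann Robin function, `d ≥ 3`.**
Let `Ω ⊆ ℝ^d` (`d ≥ 3`) be a nonempty open bounded convex set with `C⁴` boundary, `n` an
outward unit normal field on the frontier, and let `q` be the regular part of a symmetric
Neumann Green function: `Δ_x q = −1/vol(Ω)` on `Ω`, `q(·,y)` and its gradient `Dq(·,y)`
extend continuously to the closure, and `⟪∇_x G + ∇_x q, n⟫ = 0` on the frontier. Then there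
are `c₁, c₂ > 0` with `q(x,x) ≤ c₁ − c₂·dist(x,∂Ω)^{2−d}` for all `x ∈ Ω`. -/
theorem stmt5 (d : ℕ) (hd : 3 ≤ d) (Ω : Set (EuclideanSpace ℝ (Fin d)))
    (hopen : IsOpen Ω) (hbd : Bornology.IsBounded Ω) (hconv : Convex ℝ Ω) (hne : Ω.Nonempty)
    (hC4 : IsC4Boundary Ω)
    (n : EuclideanSpace ℝ (Fin d) → EuclideanSpace ℝ (Fin d))
    (hn1 : ∀ x ∈ frontier Ω, ‖n x‖ = 1)
    (hn2 : ∀ x ∈ frontier Ω, ∀ w ∈ Ω, ⟪w - x, n x⟫ ≤ 0)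
    (q : EuclideanSpace ℝ (Fin d) → EuclideanSpace ℝ (Fin d) → ℝ)
    (Dq : EuclideanSpace ℝ (Fin d) → EuclideanSpace ℝ (Fin d) → EuclideanSpace ℝ (Fin d))
    (hsymm : ∀ x ∈ Ω, ∀ y ∈ Ω, q x y = q y x)
    (hsmooth : ∀ y ∈ Ω, ContDiffOn ℝ 2 (fun x => q x y) Ω)
    (hlap : ∀ y ∈ Ω, ∀ x ∈ Ω, ∑ i : Fin d,
        iteratedFDerivWithin ℝ 2 (fun x => q x y) Ω x
          ![EuclideanSpace.single i 1, EuclideanSpace.single i 1]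
      = -1 / (MeasureTheory.volume Ω).toReal)
    (hgrad : ∀ y ∈ Ω, ∀ x ∈ Ω, HasGradientAt (fun x => q x y) (Dq x y) x)
    (hqcont : ∀ y ∈ Ω, ContinuousOn (fun x => q x y) (closure Ω))
    (hDqcont : ∀ y ∈ Ω, ContinuousOn (fun x => Dq x y) (closure Ω))
    (hneu : ∀ y ∈ Ω, ∀ x ∈ frontier Ω,
      ⟪gradient (fun x' => fundSol d x' y) x + Dq x y, n x⟫ = 0) :
    ∃ c₁ > 0, ∃ c₂ > 0, ∀ x ∈ Ω,
      q x x ≤ c₁ - c₂ * Metric.infDist x (frontier Ω) ^ ((2 : ℝ) - d) := by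
  have hω := sphereArea_pos hd
  have hd3 : (3 : ℝ) ≤ d := by exact_mod_cast hd
  have : Nonempty (Fin d) := ⟨⟨0, by omega⟩⟩
  have hfr : (frontier Ω).Nonempty := by
    refine nonempty_frontier_iff.2 ⟨hne, ?_⟩
    rintro rfl
    exact NormedSpace.unbounded_univ ℝ _ hbd
  obtain ⟨y₀, r₀, hr₀, N, hball, hN⟩ := exists_ball_uniform_bound (ι := Ω) hopen hne
    (u := fun y x => q x y) (fun y => (hqcont y y.2).mono subset_closure) (fun x hx => by
      obtain ⟨C, hC⟩ := hbd.isCompact_closure.bddAbove_image (hqcont x hx)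
      exact ⟨C, fun y => (hsymm x hx y y.2).le.trans
        (hC (Set.mem_image_of_mem _ (subset_closure y.2)))⟩)
  have hy₀ : y₀ ∈ Ω := hball (Metric.mem_ball_self hr₀)
  obtain ⟨R, hR⟩ := hbd.closure.subset_closedBall y₀
  set r := r₀ / 2 with hr_def
  have hr : 0 < r := half_pos hr₀
  set V : ℝ := -1 / (MeasureTheory.volume Ω).toReal
  set M : ℝ := |V| + 1
  have hM : 0 < M := by positivity
  set s : ℝ := (R ^ 2) ^ (-(d : ℝ) / 2)
  have hRpos : 0 < R := by
    obtain ⟨p, hp⟩ := hfr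
    have h₁ : dist p y₀ ≤ R := hR (frontier_subset_closure hp)
    rw [hopen.frontier_eq] at hp
    exact (dist_pos.2 fun h : p = y₀ => hp.2 (h ▸ hy₀)).trans_le h₁
  have hs : 0 < s := by positivity
  set A : ℝ := sphereArea d * (M + 1) / s
  have hA : 0 < A := by positivity
  set ρ : ℝ := r ^ ((2 : ℝ) - d) / (((2 : ℝ) - d) * sphereArea d)
  have hρ : ρ ≤ 0 := div_nonpos_of_nonneg_of_nonpos (by positivity)
    (mul_nonpos_of_nonpos_of_nonneg (by linarith) hω.le)
  set C : ℝ := N - (A * ρ - M / 2 * r ^ 2) - ρ with hC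
  have main : ∀ y ∈ Ω, q y y ≤
      C + (2 * Metric.infDist y (frontier Ω)) ^ ((2 : ℝ) - d) /
        (((2 : ℝ) - d) * sphereArea d) := by
    intro y hy
    obtain ⟨hδ, y', hy', hyy', hrefl⟩ := exists_reflection hopen hfr hn1 hn2 hy
    have hGy : fundSol d y y' = (2 * Metric.infDist y (frontier Ω)) ^ ((2 : ℝ) - d) /
        (((2 : ℝ) - d) * sphereArea d) := by rw [fundSol, hyy']
    rw [← hGy]
    have hy'far : ∀ z, dist z y₀ ≤ r → r ≤ ‖z - y'‖ := by
      intro z hz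
      have h₁ : r₀ ≤ dist y' y₀ := by
        by_contra! h
        exact hy' (subset_closure (hball h))
      have h₂ := dist_triangle y' z y₀
      rw [← dist_eq_norm, dist_comm]
      linarith
    have hne' : ∀ z ∈ closure Ω, z ≠ y' := fun z hz h => hy' (h ▸ hz)
    rcases lt_or_ge (dist y y₀) r with hyr | hyr
    · have h₁ := hN y (by rw [Metric.mem_ball]; linarith) ⟨y, hy⟩
      have h₂ := le_fundSol hd hr (hy'far y hyr.le)
      have h₃ : A * ρ ≤ 0 := mul_nonpos_of_nonneg_of_nonpos hA.le hρ
      have h₄ : 0 ≤ M / 2 * r ^ 2 := by positivity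
      simp only at h₁
      linarith
    set f : EuclideanSpace ℝ (Fin d) → ℝ := fun x =>
      q x y - (A * fundSol d x y₀ - M / 2 * ‖x - y₀‖ ^ 2) - fundSol d x y' with hf
    set g : EuclideanSpace ℝ (Fin d) → EuclideanSpace ℝ (Fin d) := fun x =>
      Dq x y - (A • fundSolGrad d x y₀ - M • (x - y₀)) - fundSolGrad d x y' with hg
    have hgradpart : ∀ z, z ≠ y₀ → z ≠ y' → HasGradientAt (fun x =>
        (A * fundSol d x y₀ - M / 2 * ‖x - y₀‖ ^ 2) + fundSol d x y')
        ((A • fundSolGrad d z y₀ - M • (z - y₀)) + fundSolGrad d z y') z := by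
      intro z h₁ h₂
      have key := (((hasGradientAt_fundSol hd h₁).hasFDerivAt.const_mul A).sub
        ((hasFDerivAt_norm_sub_sq z y₀).const_mul (M / 2))).add
        (hasGradientAt_fundSol hd h₂).hasFDerivAt
      refine key.congr_fderiv ?_
      ext v
      simp
      ring
    have hbound : f y ≤ C := by
      refine le_of_le_on_sphere (g := g) (n := n) hopen hbd hr
        ((Metric.closedBall_subset_ball (half_lt_self hr₀)).trans hball)
        (fun p hp => hC4.eventually_sub_smul_mem hp (hn1 p hp) (hn2 p hp)) ?_ ?_ ?_ ?_ ?_ ?_ hy hyr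
      · intro z hz hz0
        have key := (hgrad y hy z hz).hasFDerivAt.sub
          (hgradpart z hz0 (hne' z (subset_closure hz))).hasFDerivAt
        rw [← map_sub, ← sub_sub] at key
        exact key.congr_of_eventuallyEq (Eventually.of_forall fun x => (sub_sub _ _ _))
      · have h₁ : ContinuousOn (fun x => q x y) (closure Ω \ {y₀}) :=
          (hqcont y hy).mono Set.sdiff_subset
        refine (h₁.sub (fun z hz => (hgradpart z hz.2
          (hne' z hz.1)).differentiableAt.continuousAt.continuousWithinAt)).congr
          fun z hz => sub_sub _ _ _
      · have hc : ∀ a, ContinuousOn (fun x => fundSolGrad d x a) {a}ᶜ := fun a z hz => by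
          obtain ⟨H, hH, -⟩ := exists_hasFDerivAt_fundSolGrad (d := d) (x := z) (a := a) hz
          exact hH.continuousAt.continuousWithinAt
        refine (((hDqcont y hy).mono Set.sdiff_subset).sub
          ((((hc y₀).mono fun z hz => hz.2).const_smul A).sub (by fun_prop))).sub
          ((hc y').mono fun z hz => hne' z hz.1)
      · intro z hz hz0
        obtain ⟨H₁, hH₁, ht₁⟩ := exists_hasFDerivAt_gradient hopen (hsmooth y hy) (hgrad y hy) hz
        obtain ⟨H₂, hH₂, ht₂⟩ := exists_hasFDerivAt_fundSolGrad hz0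
        obtain ⟨H₃, hH₃, ht₃⟩ := exists_hasFDerivAt_fundSolGrad (hne' z (subset_closure hz))
        refine ⟨_, (hH₁.sub ((hH₂.const_smul A).sub
          (((hasFDerivAt_id z).sub_const y₀).const_smul M))).sub hH₃, ?_⟩
        have hsum : ∑ i, ⟪((H₁ - (A • H₂ - M • ContinuousLinearMap.id ℝ
            (EuclideanSpace ℝ (Fin d)))) - H₃)
            (EuclideanSpace.single i 1), EuclideanSpace.single i 1⟫ = V + (d : ℝ) * M := by
          simp only [sub_apply, smul_apply,
            ContinuousLinearMap.id_apply, inner_sub_left, real_inner_smul_left,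
            Finset.sum_sub_distrib, ← Finset.mul_sum, ht₁, ht₂, ht₃, hlap y hy z hz]
          simp [V]
          ring
        refine lt_of_lt_of_eq ?_ hsum.symm
        have := neg_abs_le V
        nlinarith [abs_nonneg V]
      · intro p hp
        have hpc := frontier_subset_closure hp
        have hpΩ : p ∉ Ω := by
          rw [hopen.frontier_eq] at hp
          exact hp.2
        obtain ⟨hle, hin⟩ := hrefl p hp
        have hpy : p ≠ y := fun h => hpΩ (h ▸ hy)
        have hpy₀ : p ≠ y₀ := fun h => hpΩ (h ▸ hy₀)
        have h₀ := le_inner_sub_of_ball_subset (hn2 p hp) (hn1 p hp) hr₀ hball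
        have h₁ := le_inner_sub_of_ball_subset (hn2 p hp) (hn1 p hp) hδ
          (ball_infDist_frontier_subset hopen hy)
        have hneu' := hneu y hy p hp
        rw [(hasGradientAt_fundSol hd hpy).gradient, inner_add_left, inner_fundSolGrad] at hneu'
        have hpos : 0 < ‖p - y‖ := norm_pos_iff.2 (sub_ne_zero.2 hpy)
        have hpos₀ : 0 < ‖p - y₀‖ := norm_pos_iff.2 (sub_ne_zero.2 hpy₀)
        have hmono : (‖p - y'‖ ^ 2) ^ (-(d : ℝ) / 2) ≤ (‖p - y‖ ^ 2) ^ (-(d : ℝ) / 2) :=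
          Real.rpow_le_rpow_of_nonpos (by positivity) (by gcongr) (by linarith)
        have hs₀ : s ≤ (‖p - y₀‖ ^ 2) ^ (-(d : ℝ) / 2) := by
          have : ‖p - y₀‖ ≤ R := by
            rw [← dist_eq_norm]
            exact hR hpc
          exact Real.rpow_le_rpow_of_nonpos (by positivity) (by gcongr) (by linarith)
        have hpole : M + 1 ≤ A * ((sphereArea d)⁻¹ * (‖p - y₀‖ ^ 2) ^ (-(d : ℝ) / 2)) := by
          calc M + 1 = A * ((sphereArea d)⁻¹ * s) := by simp only [A]; field_simp
            _ ≤ _ := by gcongr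
        have hpole' : M * ⟪p - y₀, n p⟫ < A * ((sphereArea d)⁻¹ *
            (‖p - y₀‖ ^ 2) ^ (-(d : ℝ) / 2)) * ⟪p - y₀, n p⟫ :=
          mul_lt_mul_of_pos_right (by linarith) (by linarith)
        have himage : (‖p - y'‖ ^ 2) ^ (-(d : ℝ) / 2) * ⟪y' - p, n p⟫ ≤
            (‖p - y‖ ^ 2) ^ (-(d : ℝ) / 2) * ⟪p - y, n p⟫ := by
          calc _ ≤ (‖p - y'‖ ^ 2) ^ (-(d : ℝ) / 2) * Metric.infDist y (frontier Ω) := by gcongr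
            _ ≤ (‖p - y‖ ^ 2) ^ (-(d : ℝ) / 2) * Metric.infDist y (frontier Ω) := by gcongr
            _ ≤ _ := by gcongr
        have himage' := mul_le_mul_of_nonneg_left himage (inv_nonneg.2 hω.le)
        have hneg : ⟪p - y', n p⟫ = -⟪y' - p, n p⟫ := by rw [← inner_neg_left, neg_sub]
        simp only [hg, inner_sub_left _ _ (n p), real_inner_smul_left, inner_fundSolGrad]
        simp only [inner_sub_left _ _ (n p)] at *
        nlinarith
      · intro z hz
        have h₁ := hN z (by rw [Metric.mem_ball, hz]; exact half_lt_self hr₀) ⟨y, hy⟩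
        have h₂ := le_fundSol hd hr (hy'far z hz.le)
        have h₃ : fundSol d z y₀ = ρ := by rw [fundSol, ← dist_eq_norm, hz]
        have h₄ : ‖z - y₀‖ = r := by rw [← dist_eq_norm, hz]
        simp only [hf, h₃, h₄]
        simp only at h₁
        linarith
    have h₁ : A * fundSol d y y₀ ≤ 0 :=
      mul_nonpos_of_nonneg_of_nonpos hA.le (fundSol_nonpos hd y y₀)
    have h₂ : 0 ≤ M / 2 * ‖y - y₀‖ ^ 2 := by positivity
    simp only [hf] at hbound
    linarith
  refine ⟨|C| + 1, by positivity, 2 ^ ((2 : ℝ) - d) / ((d - 2) * sphereArea d),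
    div_pos (by positivity) (mul_pos (by linarith) hω), fun x hx => (main x hx).trans ?_⟩
  rw [Real.mul_rpow zero_le_two Metric.infDist_nonneg,
    show ((2 : ℝ) - d) * sphereArea d = -((d - 2) * sphereArea d) by ring, div_neg,
    mul_div_right_comm]
  linarith [le_abs_self C]
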